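/- Let λ₁, λ₂, λ₃, λ₄ be real numbers with arctan λ₁ + arctan λ₂ + arctan λ₃ + arctan λ₄ ∈ (π, 2π). Then σ₃ > σ₁, where σ₁ = Σᵢ λᵢ and σ₃ = Σ_{i<j<k} λᵢλⱼλₖ. -/

import Mathlib

open Real

theorem sin_arctan_eq_mul_cos_arctan (x : ℝ) : sin (arctan x) = x * cos (arctan x) := by
  rw [← tan_mul_cos (cos_arctan_pos x).ne', tan_arctan]

theorem sin_sum_four_arctan (a b c d : ℝ) :
    sin (arctan a + arctan b + arctan c + arctan d) =
      cos (arctan a) * cos (arctan b) * cos (arctan c) * cos (arctan d) *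
        ((a + b + c + d) - (a * b * c + a * b * d + a * c * d + b * c * d)) := by
  simp only [sin_add, cos_add, sin_arctan_eq_mul_cos_arctan]
  ring

theorem stmt_18 (l₁ l₂ l₃ l₄ : ℝ)
    (h : arctan l₁ + arctan l₂ + arctan l₃ + arctan l₄ ∈
      Set.Ioo π (2 * π)) :
    l₁ * l₂ * l₃ + l₁ * l₂ * l₄ + l₁ * l₃ * l₄ + l₂ * l₃ * l₄ >
      l₁ + l₂ + l₃ + l₄ := by
  have hsin : sin (arctan l₁ + arctan l₂ + arctan l₃ + arctan l₄) < 0 := by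
    rw [← sin_sub_two_pi]
    exact sin_neg_of_neg_of_neg_pi_lt (by linarith [h.2]) (by linarith [h.1])
  have hcos : 0 < cos (arctan l₁) * cos (arctan l₂) * cos (arctan l₃) * cos (arctan l₄) :=
    mul_pos (mul_pos (mul_pos (cos_arctan_pos _) (cos_arctan_pos _)) (cos_arctan_pos _))
      (cos_arctan_pos _)
  rw [sin_sum_four_arctan] at hsin
  exact sub_neg.mp (neg_of_mul_neg_right hsin hcos.le)
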